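/- arXiv:1111.1084 — 2 statements merged into one kernel-verified Lean document; each statement's English description precedes it below -/
import Mathlib

section
/- Let A be an m×n matrix whose entries are 0's and 1's, and suppose the maximal diagonal sum J of A (i.e., the maximum over all injective partial assignments of rows to columns of size min(m,n) of the sum of the selected entries) satisfies J < min(m,n). Then A contains an a×b zero submatrix (a submatrix, obtained by selecting a rows and b columns, all of whose entries are 0) with a + b = m + n − J. -/
open Finset in
/-- **Deficiency form of Hall's theorem.** Either the relation `r` admits a partial matching of
size `k`, or there is a set of rows and a set of columns, unrelated under `r`, whose sizes add up
to more than `card α + card β - k`. -/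
theorem exists_partial_matching_or_unrelated {α β : Type*} [Fintype α] [Fintype β]
    (r : α → β → Prop) (k : ℕ) (hk : k ≤ Fintype.card α) :
    (∃ (p : Fin k ↪ α) (q : Fin k ↪ β), ∀ i, r (p i) (q i)) ∨
      ∃ (R : Finset α) (C : Finset β),
        Fintype.card α + Fintype.card β < R.card + C.card + k ∧
          ∀ i ∈ R, ∀ j ∈ C, ¬ r i j := by
  classical
  let t : α → Finset (β ⊕ Fin (Fintype.card α - k)) := fun i =>
    (univ.filter (r i)).disjSum univ
  by_cases hall : ∀ s : Finset α, s.card ≤ (s.biUnion t).card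
  · left
    obtain ⟨f, hf, hft⟩ := (all_card_le_biUnion_card_iff_exists_injective t).1 hall
    let T : Finset α := univ.filter fun i => (f i).isLeft
    have hcompl : (univ.filter fun i => ¬ (f i).isLeft).card ≤ Fintype.card α - k := by
      have hle := card_le_card_of_injOn (s := univ.filter fun i => ¬ (f i).isLeft)
        (t := (univ : Finset (Fin (Fintype.card α - k))).map Function.Embedding.inr) f
        (by
          intro i hi
          rcases hfi : f i with b | b <;> simp_all)
        hf.injOn
      simpa using hle
    have hT : k ≤ T.card := by
      have := card_filter_add_card_filter_not (s := (univ : Finset α)) fun i => (f i).isLeft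
      rw [card_univ] at this
      change T.card + _ = _ at this
      omega
    let p : Fin k ↪ α :=
      ((Fin.castLEEmb hT).trans T.equivFin.symm.toEmbedding).trans (Function.Embedding.subtype _)
    have hp : ∀ i, ∃ b, f (p i) = Sum.inl b := fun i =>
      Sum.isLeft_iff.1 (mem_filter.1 (T.equivFin.symm (Fin.castLE hT i)).2).2
    choose q hq using hp
    refine ⟨p, ⟨q, fun i j hij => p.injective (hf ?_)⟩, fun i => ?_⟩
    · rw [hq, hq, hij]
    · change r (p i) (q i)
      have := hft (p i)
      rw [hq] at this
      simpa [t] using this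
  · right
    push Not at hall
    obtain ⟨s, hs⟩ := hall
    refine ⟨s, univ.filter fun j => ∀ i ∈ s, ¬ r i j, ?_, fun i hi j hj =>
      (mem_filter.1 hj).2 i hi⟩
    have hsub : (univ.filter fun j => ¬ ∀ i ∈ s, ¬ r i j).disjSum univ ⊆ s.biUnion t := by
      have hpos : s.Nonempty := by
        rw [← card_pos]
        omega
      obtain ⟨i₀, hi₀⟩ := hpos
      rintro (b | b) hb
      · simpa [t] using hb
      · simpa [t] using ⟨i₀, hi₀⟩
    have hcard := card_le_card hsub
    rw [card_disjSum, card_univ, Fintype.card_fin] at hcard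
    have := card_filter_add_card_filter_not (s := (univ : Finset β)) fun j => ∀ i ∈ s, ¬ r i j
    rw [card_univ] at this
    omega

/-- An embedding of `Fin k` into `Fin m` extends to `Fin (k + e)` if `k + e ≤ m`. -/
theorem exists_embedding_extend {k e m : ℕ} (h : k + e ≤ m) (p : Fin k ↪ Fin m) :
    ∃ p' : Fin (k + e) ↪ Fin m, ∀ i, p' (Fin.castAdd e i) = p i := by
  obtain ⟨p', hp'⟩ := Fin.Embedding.restrictSurjective_of_add_le_natCard (by simpa using h) p
  exact ⟨p', fun i => DFunLike.congr_fun hp' i⟩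

/-- Finite sets can be shrunk so that their sizes add up to any smaller number. -/
theorem exists_subsets_card_add_eq {α β : Type*} (R : Finset α) (C : Finset β) {k : ℕ}
    (h : k ≤ R.card + C.card) :
    ∃ R' ⊆ R, ∃ C' ⊆ C, R'.card + C'.card = k := by
  obtain ⟨R', hR', hR'k⟩ := Finset.exists_subset_card_eq (min_le_right k R.card)
  obtain ⟨C', hC', hC'k⟩ := Finset.exists_subset_card_eq (n := k - min k R.card) (s := C) (by omega)
  exact ⟨R', hR', C', hC', by omega⟩

/-- **Zero submatrix lemma (König-type).** If `A` is an `m × n` matrix with entries in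
`{0,1}` and its Jacobi number `J` (the maximal diagonal sum, i.e. the maximum over all
injective assignments of `min m n` rows to columns of the sum of the selected entries)
satisfies `J < min m n`, then `A` contains an `a × b` zero submatrix with
`a + b = m + n - J`. -/
theorem stmt0 (m n : ℕ) (A : Matrix (Fin m) (Fin n) ℕ)
    (h01 : ∀ i j, A i j = 0 ∨ A i j = 1)
    (J : ℕ)
    (hJ : IsGreatest
      {s : ℕ | ∃ (r : Fin (min m n) ↪ Fin m) (c : Fin (min m n) ↪ Fin n),
        s = ∑ i, A (r i) (c i)} J)
    (hlt : J < min m n) :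
    ∃ (R : Finset (Fin m)) (C : Finset (Fin n)),
      R.card + C.card = m + n - J ∧ ∀ i ∈ R, ∀ j ∈ C, A i j = 0 := by
  rcases exists_partial_matching_or_unrelated (fun i j => A i j = 1) (J + 1)
    (by rw [Fintype.card_fin]; omega) with ⟨p, q, hpq⟩ | ⟨R, C, hcard, hRC⟩
  · exfalso
    have hub := hJ.2
    obtain ⟨e, he⟩ := Nat.exists_eq_add_of_le (Nat.succ_le_of_lt hlt)
    have hm : J + 1 + e ≤ m := by omega
    have hn : J + 1 + e ≤ n := by omega
    rw [he] at hub
    obtain ⟨p', hp'⟩ := exists_embedding_extend hm p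
    obtain ⟨q', hq'⟩ := exists_embedding_extend hn q
    have hle := hub ⟨p', q', rfl⟩
    rw [Fin.sum_univ_add] at hle
    simp [hp', hq', hpq] at hle
    omega
  · rw [Fintype.card_fin, Fintype.card_fin] at hcard
    obtain ⟨R', hR', C', hC', hk⟩ := exists_subsets_card_add_eq R C (k := m + n - J) (by omega)
    exact ⟨R', C', hk, fun i hi j hj => (h01 i j).resolve_right (hRC i (hR' hi) j (hC' hj))⟩
end

section
/- Let K be a field and I a prime ideal in K[x₁,…,xₙ]. For any 1 ≤ k ≤ n, the degree of the elimination ideal I_k = I ∩ K[x₁,…,x_k] is at most the degree of I. -/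
open MvPolynomial

/-- The zero set of an ideal of `K[x₁,…,xₙ]` in an algebraic closure of `K`. -/
def zeroSet {K : Type*} [Field K] {n : ℕ} (I : Ideal (MvPolynomial (Fin n) K)) :
    Set (Fin n → AlgebraicClosure K) :=
  {x | ∀ f ∈ I, MvPolynomial.aeval x f = 0}

/-- The degree of an ideal `I` of dimension `d`: the maximal (finite) number of
intersection points of `V(I)` with `d` affine hyperplanes, whenever that
intersection is finite. -/
noncomputable def idealDeg {K : Type*} [Field K] {n : ℕ}
    (I : Ideal (MvPolynomial (Fin n) K)) (d : ℕ) : ℕ∞ :=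
  sSup {N : ℕ∞ | ∃ (c : Fin d → Fin n → AlgebraicClosure K)
      (c₀ : Fin d → AlgebraicClosure K),
    (zeroSet I ∩ {x | ∀ i, c₀ i + ∑ j, c i j * x j = 0}).Finite ∧
    N = Nat.card ↥(zeroSet I ∩ {x | ∀ i, c₀ i + ∑ j, c i j * x j = 0})}

theorem ringKrullDim_eq_of_isIntegral_of_injective {R S : Type*} [CommRing R] [CommRing S]
    [IsDomain S] [Algebra R S] [Algebra.IsIntegral R S]
    (hinj : Function.Injective (algebraMap R S)) :
    ringKrullDim S = ringKrullDim R := by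
  apply le_antisymm
  · refine Order.krullDim_le_of_strictMono (PrimeSpectrum.comap (algebraMap R S)) fun P Q hPQ ↦ ?_
    exact Ideal.IsIntegral.comap_lt_comap hPQ
  · refine iSup_le fun l ↦ ?_
    obtain ⟨Q, hQ, hQl⟩ := Ideal.exists_ideal_over_prime_of_isIntegral_of_isDomain (S := S)
      l.head.asIdeal (by simp [(RingHom.injective_iff_ker_eq_bot _).mp hinj])
    have : Q.LiesOver l.head.asIdeal := ⟨hQl.symm⟩
    obtain ⟨l', hl', -, -⟩ := Ideal.exists_ltSeries_of_hasGoingUp l Q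
    rw [← hl']
    exact Order.LTSeries.length_le_krullDim l'

theorem exists_ringKrullDim_eq_and_trdeg_eq (k A : Type*) [Field k] [CommRing A] [IsDomain A]
    [Algebra k A] [Algebra.FiniteType k A] :
    ∃ s : ℕ, ringKrullDim A = s ∧ Algebra.trdeg k A = s := by
  obtain ⟨s, g, hg, hint⟩ := exists_integral_inj_algHom_of_fg k A
  algebraize [g.toRingHom]
  have h1 : ringKrullDim A = s := by
    rw [ringKrullDim_eq_of_isIntegral_of_injective (R := MvPolynomial (Fin s) k) hg]
    simp
  have : FaithfulSMul (MvPolynomial (Fin s) k) A :=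
    (faithfulSMul_iff_algebraMap_injective _ _).mpr hg
  have h2 : Algebra.trdeg k A = s := by
    have h := lift_trdeg_add_eq k (MvPolynomial (Fin s) k) A
    rw [(trdeg_eq_zero : Algebra.trdeg (MvPolynomial (Fin s) k) A = 0)] at h
    simpa [MvPolynomial.trdeg_of_isDomain] using h.symm
  exact ⟨s, h1, h2⟩

theorem ringKrullDim_eq_iff_trdeg_eq (k A : Type*) [Field k] [CommRing A] [IsDomain A]
    [Algebra k A] [Algebra.FiniteType k A] (d : ℕ) :
    ringKrullDim A = d ↔ Algebra.trdeg k A = d := by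
  obtain ⟨s, h1, h2⟩ := exists_ringKrullDim_eq_and_trdeg_eq k A
  rw [h1, h2]
  norm_cast

section

attribute [local instance] MvPolynomial.algebraMvPolynomial

theorem exists_prime_le_comap_eq (K L : Type*) [Field K] [Field L] [Algebra K L] {σ : Type*}
    (P : Ideal (MvPolynomial σ K)) [P.IsPrime] (Q : Ideal (MvPolynomial σ L)) [Q.IsPrime]
    (h : P ≤ Q.comap (map (algebraMap K L))) :
    ∃ P' ≤ Q, P'.IsPrime ∧ P'.comap (map (algebraMap K L)) = P := by
  have : Module.Flat (MvPolynomial σ K) (MvPolynomial σ L) :=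
    Module.Flat.isBaseChange K _ L _ (Algebra.IsPushout.out)
  have : Q.LiesOver (Q.comap (map (algebraMap K L))) := ⟨rfl⟩
  obtain ⟨P', h1, h2, h3⟩ := Ideal.exists_ideal_le_liesOver_of_le Q h
  exact ⟨P', h1, h2, h3.over.symm⟩

theorem ringKrullDim_quotient_eq (K L : Type*) [Field K] [Field L] [Algebra K L]
    [Algebra.IsAlgebraic K L] {σ : Type*} (Q : Ideal (MvPolynomial σ L)) [Q.IsPrime] :
    ringKrullDim (MvPolynomial σ L ⧸ Q) =
      ringKrullDim (MvPolynomial σ K ⧸ Q.comap (map (algebraMap K L))) := by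
  have : Algebra.IsIntegral (MvPolynomial σ K) (MvPolynomial σ L) :=
    ⟨fun f ↦ MvPolynomial.isIntegral_iff_isIntegral_coeff.mpr fun _ ↦
      Algebra.IsIntegral.isIntegral _⟩
  exact ringKrullDim_eq_of_isIntegral_of_injective
    (R := MvPolynomial σ K ⧸ Q.comap (algebraMap (MvPolynomial σ K) (MvPolynomial σ L)))
    Ideal.algebraMap_quotient_injective

end

theorem exists_ne_zero_aeval_mem {k A : Type*} [Field k] [CommRing A] [Algebra k A] {J : Ideal A}
    {d : ℕ} (hd : ∀ P : Ideal A, P.IsPrime → J ≤ P → Algebra.trdeg k (A ⧸ P) ≤ d)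
    {ι : Type*} [Finite ι] (hι : d < Nat.card ι) (z : ι → A) :
    ∃ Q : MvPolynomial ι k, Q ≠ 0 ∧ aeval z Q ∈ J := by
  by_contra! H
  let S : Submonoid A :=
    (nonZeroDivisors (MvPolynomial ι k)).map (aeval z : MvPolynomial ι k →ₐ[k] A)
  obtain ⟨P, hP, hJP, hPS⟩ := Ideal.exists_le_prime_disjoint J S (by
    rw [Set.disjoint_left]
    rintro _ hJ ⟨Q, hQ, rfl⟩
    exact H Q (nonZeroDivisors.ne_zero hQ) hJ)
  have hind : AlgebraicIndependent k (fun i ↦ Ideal.Quotient.mkₐ k P (z i)) := by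
    rw [algebraicIndependent_iff]
    intro Q hQ
    by_contra h0
    refine (Set.disjoint_left.mp hPS : ∀ ⦃a⦄, a ∈ P → a ∉ S) ?_
      ⟨Q, mem_nonZeroDivisors_of_ne_zero h0, rfl⟩
    have : Ideal.Quotient.mkₐ k P (aeval z Q) = 0 := by
      rw [← hQ]; exact (comp_aeval_apply _ _ _)
    exact Ideal.Quotient.eq_zero_iff_mem.mp this
  have h1 := hind.lift_cardinalMk_le_trdeg
  have h2 := h1.trans (Cardinal.lift_le.mpr (hd P hP hJP))
  rw [← Nat.cast_card] at h2
  simp only [Cardinal.lift_natCast, Nat.cast_le] at h2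
  omega

theorem isAlgebraic_of_zariskisMainProperty {R : Type*} (B : Type*) {D : Type*} [CommRing R]
    [CommRing B] [CommRing D] [IsDomain D] [Algebra R D] [Algebra R B] [Algebra B D]
    [IsScalarTower R B D] [FaithfulSMul B D] {p : Ideal D} (h : Algebra.ZariskisMainProperty R p) :
    Algebra.IsAlgebraic B D := by
  have hB : Function.Injective (algebraMap B D) := FaithfulSMul.algebraMap_injective B D
  have : IsDomain B := hB.isDomain
  obtain ⟨r, hrp, hr, hx⟩ := Algebra.zariskisMainProperty_iff.mp h
  have hr0 : r ≠ 0 := fun h0 ↦ hrp (h0 ▸ p.zero_mem)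
  refine ⟨fun x ↦ ?_⟩
  obtain ⟨m, hm⟩ := hx x
  exact IsAlgebraic.of_mul (mem_nonZeroDivisors_of_ne_zero (pow_ne_zero m hr0))
    ((hr.pow m).tower_top (A := B)).isAlgebraic (hm.tower_top (A := B)).isAlgebraic

theorem exists_mem_aeval_eq_zero {R Ω : Type*} [CommRing R] [Field Ω] [IsAlgClosed Ω] [Algebra R Ω]
    (M : Ideal (integralClosure R Ω)) [hM : M.IsPrime] {f : Polynomial R} (hf : f.Monic)
    (h : algebraMap R (integralClosure R Ω) (f.coeff 0) ∈ M) :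
    ∃ b ∈ M, Polynomial.aeval (b : Ω) f = 0 := by
  have hroots : ∀ b ∈ (f.map (algebraMap R Ω)).roots, Polynomial.aeval b f = 0 := fun b hb ↦ by
    simpa [Polynomial.aeval_def, Polynomial.eval_map] using (Polynomial.mem_roots'.mp hb).2
  obtain ⟨s, hs⟩ : ∃ s : Multiset (integralClosure R Ω),
      s.map (algebraMap _ Ω) = (f.map (algebraMap R Ω)).roots := by
    have hmem : ∀ b ∈ (f.map (algebraMap R Ω)).roots, b ∈ integralClosure R Ω :=
      fun b hb ↦ ⟨f, hf, by simpa [Polynomial.aeval_def] using hroots b hb⟩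
    refine ⟨(f.map (algebraMap R Ω)).roots.attach.map fun b ↦ ⟨b.1, hmem b.1 b.2⟩, ?_⟩
    rw [Multiset.map_map]
    exact Multiset.attach_map_val _
  have hprod : algebraMap R (integralClosure R Ω) (f.coeff 0) = (s.map (fun b ↦ -b)).prod := by
    apply FaithfulSMul.algebraMap_injective (integralClosure R Ω) Ω
    have := (IsAlgClosed.splits (f.map (algebraMap R Ω))).eval_eq_prod_roots_of_monic (hf.map _) 0
    rw [← hs, ← Polynomial.coeff_zero_eq_eval_zero, Polynomial.coeff_map] at this
    rw [← IsScalarTower.algebraMap_apply, this, map_multiset_prod, Multiset.map_map,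
      Multiset.map_map]
    simp [Function.comp_def]
  rw [hprod, hM.multiset_prod_mem_iff_exists_mem] at h
  obtain ⟨_, hb', hbM⟩ := h
  obtain ⟨b, hb, rfl⟩ := Multiset.mem_map.mp hb'
  exact ⟨b, neg_mem_iff.mp hbM, hroots _ (hs ▸ Multiset.mem_map_of_mem _ hb)⟩

open Algebra in
theorem exists_algHom_of_zariskisMainProperty {R D Ω : Type*} [CommRing R] [IsDomain R]
    [IsIntegrallyClosed R] [CommRing D] [IsDomain D] [Algebra R D] [FaithfulSMul R D]
    [Algebra.FiniteType R D] [Field Ω] [IsAlgClosed Ω] [Algebra R Ω] [FaithfulSMul R Ω]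
    (p : Ideal D) [p.IsPrime] (hZ : ZariskisMainProperty R p)
    (M : Ideal (integralClosure R Ω)) [M.IsPrime]
    (hM : M.comap (algebraMap R _) = p.comap (algebraMap R D)) :
    ∃ φ : D →ₐ[R] Ω, Function.Injective φ ∧ ∀ x, x ∈ p ↔ ∃ a ∈ M, ∃ b ∉ M, (b : Ω) * φ x = a := by
  have halg : Algebra.IsAlgebraic R D := isAlgebraic_of_zariskisMainProperty R hZ
  let F := FractionRing R
  let E := FractionRing D
  have : FaithfulSMul R E := .trans R D E
  let := FractionRing.liftAlgebra R E
  let : Algebra F Ω := FractionRing.liftAlgebra R Ω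
  have : Algebra.IsAlgebraic D E := IsLocalization.isAlgebraic _ (nonZeroDivisors D)
  have : Algebra.IsAlgebraic R E := .trans R D E
  have : Algebra.IsAlgebraic F E := .extendScalars (FaithfulSMul.algebraMap_injective R F)
  have : IsScalarTower R F E := inferInstance
  have : IsScalarTower R F Ω := inferInstance
  have : Module.Finite F E := by
    have : EssFiniteType R D := inferInstance
    have : EssFiniteType R E := .comp R D E
    have : EssFiniteType F E := .of_comp R F E
    exact Algebra.finite_of_essFiniteType_of_isAlgebraic
  have : Finite (E →ₐ[F] Ω) := inferInstance
  let D' := integralClosure R D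
  let φ (ψ : E →ₐ[F] Ω) : D →ₐ[R] Ω := (ψ.restrictScalars R).comp (IsScalarTower.toAlgHom R D E)
  let φ' (ψ : E →ₐ[F] Ω) : D' →ₐ[R] integralClosure R Ω := AlgHom.mapIntegralClosure (φ ψ)
  have hC : ∀ x : D, x ∈ p → ∀ hx : IsIntegral R x, ∃ ψ : E →ₐ[F] Ω, φ' ψ ⟨x, hx⟩ ∈ M := by
    intro x hxp hx
    obtain ⟨b, hbM, hb⟩ := exists_mem_aeval_eq_zero M (minpoly.monic hx) (by
      rw [← Ideal.mem_comap, hM, Ideal.mem_comap]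
      have h0 := minpoly.aeval R x
      rw [← Polynomial.divX_mul_X_add (minpoly R x)] at h0
      simp only [map_add, map_mul, Polynomial.aeval_X, Polynomial.aeval_C] at h0
      rw [eq_neg_of_add_eq_zero_right h0]
      exact neg_mem (p.mul_mem_left _ hxp))
    obtain ⟨ψ, hψ⟩ := IntermediateField.exists_algHom_of_splits_of_aeval (F := F) (E := E) (K := Ω)
      (fun s ↦ ⟨Algebra.IsIntegral.isIntegral s, IsAlgClosed.splits _⟩)
      (x := algebraMap D E x) (y := (b : Ω)) (by
        rw [minpoly.isIntegrallyClosed_eq_field_fractions F E hx,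
          Polynomial.aeval_map_algebraMap, hb])
    refine ⟨ψ, ?_⟩
    convert hbM
    exact Subtype.ext hψ
  obtain ⟨ψ₀, -⟩ := hC 0 p.zero_mem isIntegral_zero
  obtain ⟨ψ, -, hψ⟩ := (Ideal.subset_union_prime_finite (Set.finite_univ (α := E →ₐ[F] Ω))
    (f := fun ψ ↦ M.comap (φ' ψ)) ψ₀ ψ₀ (fun _ _ _ _ ↦ inferInstance)
    (I := p.comap (algebraMap D' D))).mp (fun x hx ↦ by
      obtain ⟨ψ, hψ⟩ := hC x hx x.2
      exact Set.mem_biUnion (Set.mem_univ ψ) hψ)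
  have heq : p.comap (algebraMap D' D) = M.comap (φ' ψ) := by
    by_contra hne
    have hlt := Ideal.IsIntegral.comap_lt_comap (R := R) (lt_of_le_of_ne hψ hne)
    refine hlt.ne ?_
    ext x
    have := Ideal.ext_iff.mp hM x
    simp only [Ideal.mem_comap] at this ⊢
    rw [AlgHom.commutes, this, ← IsScalarTower.algebraMap_apply]
  have hiff (x : D') : (x : D) ∈ p ↔ φ' ψ x ∈ M := Ideal.ext_iff.mp heq x
  have hval (x : D') : (φ' ψ x : Ω) = φ ψ x := rfl
  obtain ⟨r, hrp, hr, hx⟩ := Algebra.zariskisMainProperty_iff.mp hZ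
  refine ⟨φ ψ, ψ.injective.comp (FaithfulSMul.algebraMap_injective D E), fun x ↦ ?_⟩
  obtain ⟨m, hm⟩ := hx x
  let y : D' := ⟨_, hm⟩
  let r' : D' := ⟨r ^ m, hr.pow m⟩
  have hr' : φ' ψ r' ∉ M := fun h ↦ hrp (‹p.IsPrime›.mem_of_pow_mem m ((hiff r').mpr h))
  have hmul : (φ' ψ r' : Ω) * φ ψ x = φ' ψ y := by simp [hval, r', y]
  refine ⟨fun h ↦ ⟨φ' ψ y, (hiff y).mp (p.mul_mem_left _ h), φ' ψ r', hr', hmul⟩, ?_⟩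
  rintro ⟨a, ha, b, hb, hab⟩
  have h1 : b * φ' ψ y = φ' ψ r' * a := by
    apply Subtype.ext
    push_cast
    rw [← hmul, ← hab]; ring
  have h2 : φ' ψ y ∈ M := (‹M.IsPrime›.mem_or_mem (h1 ▸ M.mul_mem_left _ ha)).resolve_left hb
  exact (‹p.IsPrime›.mem_or_mem ((hiff y).mpr h2)).resolve_left
    fun h ↦ hrp (‹p.IsPrime›.mem_of_pow_mem m h)

theorem exists_algHom_ker_eq {L D : Type*} [Field L] [IsAlgClosed L] [CommRing D] [Algebra L D]
    [Algebra.FiniteType L D] (m : Ideal D) [m.IsMaximal] :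
    ∃ ε : D →ₐ[L] L, RingHom.ker ε = m := by
  let _ := Ideal.Quotient.field m
  have : Module.Finite L (D ⧸ m) := finite_of_finite_type_of_isJacobsonRing _ _
  let ε : D →ₐ[L] L := (IsAlgClosed.lift : (D ⧸ m) →ₐ[L] L).comp (Ideal.Quotient.mkₐ L m)
  refine ⟨ε, (Ideal.IsMaximal.eq_of_le ‹_› (RingHom.ker_ne_top _) fun x hx ↦ ?_).symm⟩
  simp [ε, RingHom.mem_ker, Ideal.Quotient.eq_zero_iff_mem.mpr hx]

theorem exists_notMem_ker_of_finite {L D : Type*} [Field L] [CommRing D] [Algebra L D]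
    (T : Finset (D →ₐ[L] L)) (ε : D →ₐ[L] L) :
    ∃ f : D, ε f ≠ 0 ∧ ∀ ε' ∈ T, ε' ≠ ε → ε' f = 0 := by
  classical
  have h (ε' : D →ₐ[L] L) : ∃ a, ε a ≠ 0 ∧ (ε' ≠ ε → ε' a = 0) := by
    by_cases hε : ε' = ε
    · exact ⟨1, by simp, fun h ↦ (h hε).elim⟩
    obtain ⟨a, ha⟩ := not_forall.mp (mt AlgHom.ext hε)
    exact ⟨a - algebraMap L D (ε' a), by simpa [sub_eq_zero] using Ne.symm ha, by simp⟩
  choose a ha ha' using h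
  refine ⟨∏ ε' ∈ T, a ε', by simp [map_prod, Finset.prod_ne_zero_iff, ha], fun ε' hT hne ↦ ?_⟩
  rw [map_prod]
  exact Finset.prod_eq_zero hT (ha' ε' hne)

theorem zariskisMainProperty_ker_of_finite {L D : Type*} [Field L] [IsAlgClosed L] [CommRing D]
    [Algebra L D] [Algebra.FiniteType L D] {ι : Type*} [Algebra (MvPolynomial ι L) D]
    [IsScalarTower L (MvPolynomial ι L) D]
    (hfin : {ε : D →ₐ[L] L | ∀ i, ε (algebraMap (MvPolynomial ι L) D (X i)) = 0}.Finite)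
    (ε : D →ₐ[L] L) (hε : ∀ i, ε (algebraMap (MvPolynomial ι L) D (X i)) = 0) :
    Algebra.ZariskisMainProperty (MvPolynomial ι L) (RingHom.ker ε) := by
  obtain ⟨f, hf, hf'⟩ := exists_notMem_ker_of_finite hfin.toFinset ε
  have : Algebra.FiniteType (MvPolynomial ι L) D := .of_restrictScalars_finiteType L _ _
  have : IsJacobsonRing D := isJacobsonRing_of_finiteType (A := L)
  have hmax : (RingHom.ker ε).IsMaximal :=
    RingHom.ker_isMaximal_of_surjective ε fun x ↦ ⟨algebraMap L D x, ε.commutes x⟩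
  have key : ∀ q : Ideal D, q.IsPrime → f ∉ q →
      (∀ i, algebraMap (MvPolynomial ι L) D (X i) ∈ q) → RingHom.ker ε = q := by
    intro q hq hfq hX
    refine hmax.eq_of_le hq.ne_top fun g hg ↦ (hq.mem_or_mem (?_ : f * g ∈ q)).resolve_left hfq
    rw [← IsJacobsonRing.out ‹_› hq.isRadical, Ideal.jacobson, Ideal.mem_sInf]
    rintro m ⟨hqm, hm⟩
    obtain ⟨ε', rfl⟩ := exists_algHom_ker_eq (L := L) m
    rw [RingHom.mem_ker, map_mul]
    by_cases h : ε' = ε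
    · subst h
      rw [(hg : ε' g = 0), mul_zero]
    · rw [hf' ε' (hfin.mem_toFinset.mpr fun i ↦ hqm (hX i)) h, zero_mul]
  have := hmax.isPrime
  suffices Algebra.QuasiFiniteAt (MvPolynomial ι L) (RingHom.ker ε) from .of_finiteType _
  refine Algebra.QuasiFiniteAt.of_isOpen_singleton_fiber ⟨RingHom.ker ε, hmax.isPrime⟩ ?_
  refine ⟨PrimeSpectrum.basicOpen f, PrimeSpectrum.isOpen_basicOpen, ?_⟩
  ext ⟨q, hq⟩
  simp only [Set.mem_preimage, Set.mem_singleton_iff, SetLike.mem_coe,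
    PrimeSpectrum.mem_basicOpen]
  refine ⟨fun h ↦ Subtype.ext (PrimeSpectrum.ext (key q.asIdeal q.2 h fun i ↦ ?_).symm), fun h ↦ ?_⟩
  · have := congr((X i : MvPolynomial ι L) ∈ ($hq).asIdeal)
    simp only [PrimeSpectrum.comap_asIdeal, Ideal.mem_comap, RingHom.mem_ker, eq_iff_iff] at this
    exact this.mpr (hε i)
  · rw [show q = _ from congr_arg Subtype.val h]
    exact hf

theorem faithfulSMul_of_zariskisMainProperty {L D : Type*} [Field L] [CommRing D] [IsDomain D]
    [Algebra L D] {ι : Type*} [Finite ι] [Algebra (MvPolynomial ι L) D]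
    [IsScalarTower L (MvPolynomial ι L) D] (hι : Algebra.trdeg L D = Nat.card ι) {p : Ideal D}
    (hp : Algebra.ZariskisMainProperty (MvPolynomial ι L) p) :
    FaithfulSMul (MvPolynomial ι L) D := by
  let x (i : ι) : D := algebraMap (MvPolynomial ι L) D (X i)
  let B := Algebra.adjoin L (Set.range x)
  have haeval : aeval x = IsScalarTower.toAlgHom L (MvPolynomial ι L) D := by ext; simp [x]
  let g : MvPolynomial ι L →ₐ[L] B := (IsScalarTower.toAlgHom L (MvPolynomial ι L) D).codRestrict B
    fun f ↦ by
      rw [← haeval, show B = _ from Algebra.adjoin_range_eq_range_aeval L x]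
      exact ⟨f, rfl⟩
  let _ : Algebra (MvPolynomial ι L) B := g.toRingHom.toAlgebra
  have : IsScalarTower (MvPolynomial ι L) B D := .of_algebraMap_eq fun _ ↦ rfl
  have : Algebra.IsAlgebraic B D := isAlgebraic_of_zariskisMainProperty B hp
  have h := Algebra.IsAlgebraic.isTranscendenceBasis_of_lift_le_trdeg_of_finite L x (by
    simp [hι, Nat.cast_card])
  rw [faithfulSMul_iff_algebraMap_injective]
  have := h.1
  rw [AlgebraicIndependent, haeval] at this
  exact this

theorem exists_lift_point {K L : Type*} [Field K] [Field L] [Algebra K L] [Algebra.IsAlgebraic K L]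
    [IsAlgClosed L] {σ : Type*} [Finite σ] (I : Ideal (MvPolynomial σ K)) [I.IsPrime] {ι : Type*}
    [Finite ι] (hdim : ringKrullDim (MvPolynomial σ K ⧸ I) = Nat.card ι)
    (z : ι → MvPolynomial σ L)
    (hfin : {x : σ → L | (∀ f ∈ I, aeval x f = 0) ∧ ∀ i, aeval x (z i) = 0}.Finite)
    {Ω : Type*} [Field Ω] [IsAlgClosed Ω] [Algebra (MvPolynomial ι L) Ω]
    [FaithfulSMul (MvPolynomial ι L) Ω] [Algebra L Ω] [IsScalarTower L (MvPolynomial ι L) Ω]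
    [Algebra K Ω] [IsScalarTower K L Ω] (M : Ideal (integralClosure (MvPolynomial ι L) Ω))
    [M.IsPrime]
    (hM : ∀ f : MvPolynomial ι L, algebraMap _ (integralClosure (MvPolynomial ι L) Ω) f ∈ M ↔
      aeval (0 : ι → L) f = 0)
    (x : σ → L) (hxI : ∀ f ∈ I, aeval x f = 0) (hxz : ∀ i, aeval x (z i) = 0) :
    ∃ w : σ → Ω, (∀ i, aeval w (z i) = algebraMap (MvPolynomial ι L) Ω (X i)) ∧
      (∀ f : MvPolynomial σ K, aeval w f = 0 ↔ f ∈ I) ∧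
      ∀ j, ∃ a ∈ M, ∃ b ∉ M, (b : Ω) * (w j - algebraMap L Ω (x j)) = a := by
  have hQ : (RingHom.ker (aeval x : MvPolynomial σ L →ₐ[L] L)).IsPrime := RingHom.ker_isPrime _
  obtain ⟨P, hPQ, hP, hPI⟩ := exists_prime_le_comap_eq K L I
    (RingHom.ker (aeval x : MvPolynomial σ L →ₐ[L] L)) fun f hf ↦ by
      simpa [RingHom.mem_ker, aeval_map_algebraMap] using hxI f hf
  let D := MvPolynomial σ L ⧸ P
  let _ : Algebra (MvPolynomial ι L) D :=
    ((Ideal.Quotient.mkₐ L P).comp (aeval z)).toRingHom.toAlgebra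
  have hmap (f : MvPolynomial ι L) :
    algebraMap (MvPolynomial ι L) D f = Ideal.Quotient.mkₐ L P (aeval z f) := rfl
  have : IsScalarTower L (MvPolynomial ι L) D := .of_algebraMap_eq fun c ↦ by
    rw [hmap, AlgHom.commutes, AlgHom.commutes]
  have : Algebra.FiniteType L D := inferInstance
  have hdimD : Algebra.trdeg L D = Nat.card ι := by
    rw [← ringKrullDim_eq_iff_trdeg_eq, ringKrullDim_quotient_eq K L P, hPI, hdim]
  let ε : D →ₐ[L] L := Ideal.Quotient.liftₐ P (aeval x) hPQ
  have hε (f : MvPolynomial σ L) : ε (Ideal.Quotient.mkₐ L P f) = aeval x f := rfl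
  have hfin' : {ε : D →ₐ[L] L | ∀ i, ε (algebraMap (MvPolynomial ι L) D (X i)) = 0}.Finite := by
    have hcomp (ε : D →ₐ[L] L) (f : MvPolynomial σ L) :
        aeval (fun j ↦ ε (Ideal.Quotient.mkₐ L P (X j))) f = ε (Ideal.Quotient.mkₐ L P f) :=
      DFunLike.congr_fun (aeval_unique (ε.comp (Ideal.Quotient.mkₐ L P))).symm f
    refine Set.Finite.of_finite_image (f := fun ε j ↦ ε (Ideal.Quotient.mkₐ L P (X j)))
      (hfin.subset ?_) ?_
    · rintro _ ⟨ε, hε, rfl⟩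
      refine ⟨fun f hf ↦ ?_, fun i ↦ ?_⟩
      · have : map (algebraMap K L) f ∈ P := by rwa [← Ideal.mem_comap, hPI]
        rw [← aeval_map_algebraMap L, hcomp, Ideal.Quotient.mkₐ_eq_mk,
          Ideal.Quotient.eq_zero_iff_mem.mpr this, map_zero]
      · have := hε i
        rwa [hmap, aeval_X, ← hcomp] at this
    · intro ε _ ε' _ h
      refine Ideal.Quotient.algHom_ext _ (MvPolynomial.algHom_ext fun j ↦ congr_fun h j)
  have hZ := zariskisMainProperty_ker_of_finite hfin' ε fun i ↦ by
    rw [hmap, aeval_X, hε, hxz]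
  have := faithfulSMul_of_zariskisMainProperty hdimD hZ
  have : Algebra.FiniteType (MvPolynomial ι L) D := .of_restrictScalars_finiteType L _ _
  have hprime : (RingHom.ker ε).IsPrime := RingHom.ker_isPrime _
  obtain ⟨φ, hφ, hφM⟩ := exists_algHom_of_zariskisMainProperty (Ω := Ω) (RingHom.ker ε) hZ M (by
    ext f
    rw [Ideal.mem_comap, hM, Ideal.mem_comap, RingHom.mem_ker, hmap, hε]
    congr! 1
    rw [← AlgHom.comp_apply]
    congr 1
    ext i
    rw [AlgHom.comp_apply, aeval_X, aeval_X, hxz, Pi.zero_apply])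
  let φ' : MvPolynomial σ L →ₐ[L] Ω := (φ.restrictScalars L).comp (Ideal.Quotient.mkₐ L P)
  have hw (f : MvPolynomial σ L) :
      aeval (fun j ↦ φ (Ideal.Quotient.mkₐ L P (X j))) f = φ (Ideal.Quotient.mkₐ L P f) :=
    DFunLike.congr_fun (aeval_unique φ').symm f
  refine ⟨fun j ↦ φ (Ideal.Quotient.mkₐ L P (X j)), fun i ↦ ?_, fun f ↦ ?_, fun j ↦ ?_⟩
  · rw [hw, ← φ.commutes, hmap, aeval_X]
  · rw [← aeval_map_algebraMap L, hw, map_eq_zero_iff _ hφ, Ideal.Quotient.mkₐ_eq_mk,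
      Ideal.Quotient.eq_zero_iff_mem, ← hPI, Ideal.mem_comap]
  · obtain ⟨a, ha, b, hb, hab⟩ := (hφM (Ideal.Quotient.mkₐ L P (X j - C (x j)))).mp (by
      rw [RingHom.mem_ker, hε, map_sub, aeval_X, aeval_C, Algebra.algebraMap_self_apply, sub_self])
    refine ⟨a, ha, b, hb, ?_⟩
    rw [← hab, ← hw]
    simp

theorem exists_isTranscendenceBasis_of_adjoin_eq_top {K B A : Type*} [Field K] [CommRing B]
    [CommRing A] [IsDomain A] [Algebra K B] [Algebra K A] [Algebra B A] [IsScalarTower K B A]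
    [FaithfulSMul B A] {τ : Type*} [Finite τ] {a : τ → A}
    (ha : Algebra.adjoin K (Set.range a) = ⊤) {d e : ℕ} (hd : Algebra.trdeg K A = d)
    (he : Algebra.trdeg K B = e) :
    ∃ (m : ℕ) (j : Fin m → τ), e + m = d ∧ IsTranscendenceBasis B (a ∘ j) := by
  have : Nontrivial B := (algebraMap B A).domain_nontrivial
  have htop : Algebra.adjoin B (Set.range a) = ⊤ := by
    rw [← Algebra.adjoin_adjoin_of_tower (R := K), ha, Algebra.coe_top, Algebra.adjoin_univ]
  have halg : Algebra.IsAlgebraic (Algebra.adjoin B (Set.range a)) A := by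
    rw [htop]
    exact ⟨fun x ↦ isAlgebraic_algebraMap (⟨x, trivial⟩ : (⊤ : Subalgebra B A))⟩
  obtain ⟨t, hta, ht⟩ := exists_isTranscendenceBasis_subset (R := B) (Set.range a)
  have : Finite t := (Set.finite_range a).subset hta
  choose j hj using fun x : t ↦ hta x.2
  let ε := Finite.equivFin t
  refine ⟨Nat.card t, j ∘ ε.symm, ?_, ?_⟩
  · have h := lift_trdeg_add_eq K B A
    rw [hd, he, ← ht.cardinalMk_eq_trdeg, ← Nat.cast_card] at h
    simp only [Cardinal.lift_natCast] at h
    exact_mod_cast h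
  · have h := ht.comp_equiv ε.symm
    rwa [show a ∘ j ∘ ε.symm = (↑) ∘ ε.symm from funext fun i ↦ hj _]

theorem exists_ringHom_of_isTranscendenceBasis {B A Ω Ω' : Type*} [CommRing B] [CommRing A]
    [IsDomain A] [Algebra B A] [FaithfulSMul B A] [Field Ω] [Field Ω'] [Algebra Ω Ω']
    [IsAlgClosed Ω'] {ι : Type*} {b : ι → A} (hb : IsTranscendenceBasis B b) {ψ : B →+* Ω}
    (hψ : Function.Injective ψ) {g : ι → Ω'} (hg : AlgebraicIndependent Ω g) :
    ∃ φ : A →+* Ω', (∀ x, φ (algebraMap B A x) = algebraMap Ω Ω' (ψ x)) ∧ ∀ i, φ (b i) = g i := by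
  have : Nontrivial B := ψ.domain_nontrivial
  let S := Algebra.adjoin B (Set.range b)
  have : Algebra.IsAlgebraic S A := hb.isAlgebraic
  let ρ : S →+* Ω' := ((aeval g : MvPolynomial ι Ω →ₐ[Ω] Ω').toRingHom.comp (map ψ)).comp
    (hb.1.aevalEquiv.symm : S →+* MvPolynomial ι B)
  have hρ : Function.Injective ρ := by
    have hg' : Function.Injective (aeval g : MvPolynomial ι Ω →ₐ[Ω] Ω') := hg
    exact (hg'.comp (map_injective ψ hψ)).comp hb.1.aevalEquiv.symm.injective
  let _ : Algebra S Ω' := ρ.toAlgebra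
  have : FaithfulSMul S Ω' := (faithfulSMul_iff_algebraMap_injective _ _).mpr hρ
  have : Module.IsTorsionFree S Ω' := FaithfulSMul.to_isTorsionFree S Ω'
  let φ : A →ₐ[S] Ω' := IsAlgClosed.lift
  have hφ (f : MvPolynomial ι B) : φ (aeval b f) = aeval g (map ψ f) := by
    have : aeval b f = algebraMap S A (hb.1.aevalEquiv f) := by simp
    rw [this, AlgHom.commutes]
    change (aeval g) (map ψ (hb.1.aevalEquiv.symm (hb.1.aevalEquiv f))) = _
    rw [AlgEquiv.symm_apply_apply]
  exact ⟨φ, fun x ↦ by simpa using hφ (C x), fun i ↦ by simpa using hφ (X i)⟩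

theorem exists_specialization {L Ω : Type*} [Field L] [IsAlgClosed L] [Field Ω] [Algebra L Ω]
    {S : Set Ω} (hS : S.Finite) :
    ∃ (B : Subalgebra L Ω) (ε : B →ₐ[L] L), S ⊆ B ∧ ∀ b : B, (b : Ω) ∈ S → b ≠ 0 → ε b ≠ 0 := by
  let B := Algebra.adjoin L (S ∪ (·⁻¹) '' S)
  have : Algebra.FiniteType L B :=
    Algebra.FiniteType.adjoin_of_finite (hS.union (hS.image _))
  obtain ⟨m, hm⟩ := Ideal.exists_maximal B
  obtain ⟨ε, -⟩ := exists_algHom_ker_eq (L := L) m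
  refine ⟨B, ε, fun x hx ↦ Algebra.subset_adjoin (Or.inl hx), fun b hb hb0 h ↦ ?_⟩
  let b' : B := ⟨(b : Ω)⁻¹, Algebra.subset_adjoin (Or.inr ⟨b, hb, rfl⟩)⟩
  have : b * b' = 1 := Subtype.ext (mul_inv_cancel₀ fun h ↦ hb0 (Subtype.ext h))
  simpa [h] using congr(ε $this)

theorem exists_ne_zero_forall_finite {K L : Type*} [Field K] [Field L] [Algebra K L]
    [Algebra.IsAlgebraic K L] {τ : Type*} [Finite τ] (I : Ideal (MvPolynomial τ K)) {d : ℕ}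
    (hd : ringKrullDim (MvPolynomial τ K ⧸ I) = d) {ι : Type*} [Finite ι] (hι : Nat.card ι = d)
    (z : ι → MvPolynomial τ L) :
    ∃ q : MvPolynomial ι L, q ≠ 0 ∧ ∀ θ : ι → L, aeval θ q ≠ 0 →
      {x : τ → L | (∀ f ∈ I, aeval x f = 0) ∧ ∀ i, aeval x (z i) = θ i}.Finite := by
  have _ := Fintype.ofFinite τ
  let J : Ideal (MvPolynomial τ L) := I.map (map (algebraMap K L))
  have hJ : ∀ P : Ideal (MvPolynomial τ L), P.IsPrime → J ≤ P →
      Algebra.trdeg L (MvPolynomial τ L ⧸ P) ≤ d := by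
    intro P hP hJP
    have h1 : ringKrullDim (MvPolynomial τ L ⧸ P) ≤ d := by
      rw [ringKrullDim_quotient_eq K L P, ← hd]
      exact ringKrullDim_le_of_surjective
        (Ideal.Quotient.factor (Ideal.map_le_iff_le_comap.mp hJP))
        (Ideal.Quotient.factor_surjective _)
    obtain ⟨s, hs, hs'⟩ := exists_ringKrullDim_eq_and_trdeg_eq L (MvPolynomial τ L ⧸ P)
    rw [hs] at h1
    rw [hs']
    exact_mod_cast h1
  have h (j : τ) := exists_ne_zero_aeval_mem hJ (ι := Option ι) (by simp [Finite.card_option, hι])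
    (fun o ↦ o.elim (X j) z)
  choose Q hQ hQJ using h
  let p (j : τ) : Polynomial (MvPolynomial ι L) := optionEquivLeft L ι (Q j)
  have hp (j : τ) : p j ≠ 0 := by simpa [p] using hQ j
  refine ⟨∏ j, (p j).leadingCoeff, Finset.prod_ne_zero_iff.mpr fun j _ ↦ by simpa using hp j,
    fun θ hθ ↦ ?_⟩
  rw [map_prod, Finset.prod_ne_zero_iff] at hθ
  let r (j : τ) : Polynomial L := (p j).map (eval θ)
  have hr (j : τ) : r j ≠ 0 := fun h ↦ hθ j (Finset.mem_univ j) <| by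
    rw [aeval_eq_eval, Polynomial.leadingCoeff, ← Polynomial.coeff_map]
    exact congr(($h).coeff _)
  refine (Set.Finite.pi' fun j ↦ Polynomial.rootSet_finite (r j) L).subset ?_
  rintro x ⟨hxI, hxz⟩ j
  refine Polynomial.mem_rootSet.mpr ⟨hr j, ?_⟩
  have h1 : aeval x (aeval (fun o : Option ι ↦ o.elim (X j) z) (Q j)) = 0 := by
    have : J ≤ RingHom.ker (aeval x : MvPolynomial τ L →ₐ[L] L) :=
      Ideal.map_le_iff_le_comap.mpr fun f hf ↦ by
        simpa [RingHom.mem_ker, aeval_map_algebraMap] using hxI f hf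
    exact this (hQJ j)
  rw [Polynomial.coe_aeval_eq_eval, ← optionEquivLeft_elim_eval, ← h1, ← AlgHom.comp_apply,
    ← aeval_eq_eval]
  congr 1
  ext o
  cases o <;> simp [← hxz]

theorem exists_injective_specialization {K L : Type*} [Field K] [Field L] [Algebra K L]
    [Algebra.IsAlgebraic K L] [IsAlgClosed L] {τ : Type*} [Finite τ] (I : Ideal (MvPolynomial τ K))
    {d : ℕ} (hd : ringKrullDim (MvPolynomial τ K ⧸ I) = d) {ι : Type*} [Finite ι]
    (hι : Nat.card ι = d) (z : ι → MvPolynomial τ L) {Ω : Type*} [Field Ω] [Algebra L Ω]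
    [Algebra K Ω] [IsScalarTower K L Ω] {θ : ι → Ω} (hθ : AlgebraicIndependent L θ)
    {T : Type*} [Finite T] {v : T → τ → Ω} (hv : Function.Injective v)
    (hvI : ∀ t, ∀ f ∈ I, aeval (v t) f = 0) (hvz : ∀ t i, aeval (v t) (z i) = θ i) :
    ∃ (θ₀ : ι → L) (x : T → τ → L), Function.Injective x ∧
      (∀ t, x t ∈ {x : τ → L | (∀ f ∈ I, aeval x f = 0) ∧ ∀ i, aeval x (z i) = θ₀ i}) ∧
      {x : τ → L | (∀ f ∈ I, aeval x f = 0) ∧ ∀ i, aeval x (z i) = θ₀ i}.Finite := by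
  obtain ⟨q, hq, hfin⟩ := exists_ne_zero_forall_finite I hd hι z
  obtain ⟨B, ε, hB, hε⟩ := exists_specialization (L := L)
    (S := Set.range (fun a : T × τ ↦ v a.1 a.2) ∪ Set.range θ ∪ {aeval θ q} ∪
      Set.range (fun a : T × T × τ ↦ v a.1 a.2.2 - v a.2.1 a.2.2))
    ((((Set.finite_range _).union (Set.finite_range _)).union (Set.finite_singleton _)).union
      (Set.finite_range _))
  let v' (t : T) (j : τ) : B := ⟨v t j, hB (.inl (.inl (.inl ⟨(t, j), rfl⟩)))⟩
  let θ' (i : ι) : B := ⟨θ i, hB (.inl (.inl (.inr ⟨i, rfl⟩)))⟩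
  have hB_inj : Function.Injective B.val := Subtype.val_injective
  have hval (t : T) (f : MvPolynomial τ L) : B.val (aeval (v' t) f) = aeval (v t) f :=
    comp_aeval_apply _ _ _
  have hvalθ : B.val (aeval θ' q) = aeval θ q := comp_aeval_apply _ _ _
  have hεval (t : T) (f : MvPolynomial τ L) :
      ε (aeval (v' t) f) = aeval (fun j ↦ ε (v' t j)) f := comp_aeval_apply _ _ _
  have hz (t : T) (i : ι) : aeval (v' t) (z i) = θ' i := hB_inj <| by
    rw [hval]; exact hvz t i
  refine ⟨fun i ↦ ε (θ' i), fun t j ↦ ε (v' t j), fun t t' h ↦ ?_,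
    fun t ↦ ⟨fun f hf ↦ ?_, fun i ↦ ?_⟩, hfin _ ?_⟩
  · by_contra hne
    obtain ⟨j, hj⟩ := not_forall.mp fun h ↦ hne (hv (funext h))
    refine hε (v' t j - v' t' j) (.inr ⟨(t, t', j), rfl⟩) (fun h ↦ hj ?_) ?_
    · exact congr(($(sub_eq_zero.mp h) : Ω))
    · rw [map_sub, sub_eq_zero]
      exact congr_fun h j
  · have : aeval (v' t) (map (algebraMap K L) f) = 0 := hB_inj <| by
      rw [hval, aeval_map_algebraMap, map_zero]
      exact hvI t f hf
    rw [← aeval_map_algebraMap L, ← hεval, this, map_zero]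
  · rw [← hεval, hz]
  · have hεθ : ε (aeval θ' q) = aeval (fun i ↦ ε (θ' i)) q := comp_aeval_apply _ _ _
    rw [← hεθ]
    refine hε _ (.inl (.inr hvalθ)) fun h ↦ hq (hθ.eq_zero_of_aeval_eq_zero q ?_)
    rw [← hvalθ, h, map_zero]

theorem exists_lift_family {K L : Type*} [Field K] [Field L] [Algebra K L] [Algebra.IsAlgebraic K L]
    [IsAlgClosed L] {σ : Type*} [Finite σ] (I : Ideal (MvPolynomial σ K)) [I.IsPrime] {ι : Type*}
    [Finite ι] (hdim : ringKrullDim (MvPolynomial σ K ⧸ I) = Nat.card ι)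
    (z : ι → MvPolynomial σ L)
    (hfin : {x : σ → L | (∀ f ∈ I, aeval x f = 0) ∧ ∀ i, aeval x (z i) = 0}.Finite)
    {Ω : Type*} [Field Ω] [IsAlgClosed Ω] [Algebra L Ω] [Algebra K Ω] [IsScalarTower K L Ω]
    {t : ι → Ω} (ht : AlgebraicIndependent L t) :
    ∃ w : {x : σ → L | (∀ f ∈ I, aeval x f = 0) ∧ ∀ i, aeval x (z i) = 0} → σ → Ω,
      Function.Injective w ∧ (∀ x i, aeval (w x) (z i) = t i) ∧
      ∀ x, ∀ f : MvPolynomial σ K, aeval (w x) f = 0 ↔ f ∈ I := by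
  let _ : Algebra (MvPolynomial ι L) Ω := (aeval t : MvPolynomial ι L →ₐ[L] Ω).toRingHom.toAlgebra
  have hmap (f : MvPolynomial ι L) : algebraMap (MvPolynomial ι L) Ω f = aeval t f := rfl
  have : FaithfulSMul (MvPolynomial ι L) Ω := (faithfulSMul_iff_algebraMap_injective _ _).mpr ht
  have : IsScalarTower L (MvPolynomial ι L) Ω := .of_algebraMap_eq fun c ↦ by
    rw [hmap, AlgHom.commutes]
  have hm : (RingHom.ker (aeval (0 : ι → L) : MvPolynomial ι L →ₐ[L] L)).IsPrime :=
    RingHom.ker_isPrime _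
  obtain ⟨M, hMprime, hMm⟩ := Ideal.exists_ideal_over_prime_of_isIntegral_of_isDomain
    (S := integralClosure (MvPolynomial ι L) Ω)
    (RingHom.ker (aeval (0 : ι → L) : MvPolynomial ι L →ₐ[L] L)) (by
      rw [(RingHom.injective_iff_ker_eq_bot _).mp
        (FaithfulSMul.algebraMap_injective (MvPolynomial ι L)
          (integralClosure (MvPolynomial ι L) Ω))]
      exact bot_le)
  have hM (f : MvPolynomial ι L) :
      algebraMap _ (integralClosure (MvPolynomial ι L) Ω) f ∈ M ↔ aeval (0 : ι → L) f = 0 := by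
    rw [← Ideal.mem_comap, hMm, RingHom.mem_ker]
  choose w hwz hwI hw using fun x : {x : σ → L | (∀ f ∈ I, aeval x f = 0) ∧
    ∀ i, aeval x (z i) = 0} ↦ exists_lift_point I hdim z hfin (Ω := Ω) M hM x x.2.1 x.2.2
  refine ⟨w, fun x y hxy ↦ Subtype.ext (funext fun j ↦ ?_), fun x i ↦ ?_, hwI⟩
  · obtain ⟨a, ha, b, hb, hab⟩ := hw x j
    obtain ⟨a', ha', b', hb', hab'⟩ := hw y j
    let c : integralClosure (MvPolynomial ι L) Ω := algebraMap (MvPolynomial ι L) _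
      (C (y.1 j - x.1 j))
    have hc : (c : Ω) = algebraMap L Ω (y.1 j) - algebraMap L Ω (x.1 j) := by
      change algebraMap (MvPolynomial ι L) Ω _ = _
      rw [hmap, aeval_C, map_sub]
    have key : b * b' * c = a * b' - a' * b := Subtype.ext <| by
      push_cast
      rw [hc, ← hab, ← hab', hxy]
      ring
    have hmem : b * b' * c ∈ M := key ▸ M.sub_mem (M.mul_mem_right _ ha) (M.mul_mem_right _ ha')
    have hcM := (hMprime.mem_or_mem hmem).resolve_left fun h ↦
      (hMprime.mem_or_mem h).elim hb hb'
    rw [hM, aeval_C, Algebra.algebraMap_self_apply, sub_eq_zero] at hcM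
    exact hcM.symm
  · rw [hwz, hmap, aeval_X]

theorem exists_extend_point_of_comap_rename {K : Type*} [Field K] {σ τ : Type*} [Finite σ] [Finite τ]
    (ρ : σ → τ) (I : Ideal (MvPolynomial τ K)) [I.IsPrime] {d e : ℕ}
    (hd : ringKrullDim (MvPolynomial τ K ⧸ I) = d)
    (he : ringKrullDim (MvPolynomial σ K ⧸
      I.comap (rename ρ : MvPolynomial σ K →ₐ[K] MvPolynomial τ K).toRingHom) = e) :
    ∃ (m : ℕ) (j : Fin m → τ), e + m = d ∧
      ∀ {Ω Ω' : Type _} [Field Ω] [Field Ω'] [Algebra K Ω] [Algebra Ω Ω'] [Algebra K Ω']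
        [IsScalarTower K Ω Ω'] [IsAlgClosed Ω'] {g : Fin m → Ω'}, AlgebraicIndependent Ω g →
      ∀ w : σ → Ω, (∀ f : MvPolynomial σ K, aeval w f = 0 ↔ rename ρ f ∈ I) →
      ∃ v : τ → Ω', (∀ s, v (ρ s) = algebraMap Ω Ω' (w s)) ∧ (∀ i, v (j i) = g i) ∧
        ∀ f ∈ I, aeval v f = 0 := by
  let J := I.comap (rename ρ : MvPolynomial σ K →ₐ[K] MvPolynomial τ K).toRingHom
  have : J.IsPrime := Ideal.comap_isPrime _ _
  let B := MvPolynomial σ K ⧸ J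
  let A := MvPolynomial τ K ⧸ I
  let q : B →ₐ[K] A := Ideal.quotientMapₐ I (rename ρ) le_rfl
  let _ : Algebra B A := q.toRingHom.toAlgebra
  have hmap (f : MvPolynomial σ K) :
    algebraMap B A (Ideal.Quotient.mk J f) = Ideal.Quotient.mk I (rename ρ f) := rfl
  have : IsScalarTower K B A := .of_algebraMap_eq fun c ↦ (q.commutes c).symm
  have : FaithfulSMul B A := (faithfulSMul_iff_algebraMap_injective _ _).mpr
    Ideal.quotientMap_injective
  have ha : Algebra.adjoin K (Set.range fun s ↦ Ideal.Quotient.mk I (X s)) = ⊤ := by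
    have h := congr(Subalgebra.map (Ideal.Quotient.mkₐ K I) $(adjoin_range_X (R := K) (σ := τ)))
    rw [AlgHom.map_adjoin, Algebra.map_top,
      (AlgHom.range_eq_top _).mpr (Ideal.Quotient.mkₐ_surjective K I), ← Set.range_comp] at h
    exact h
  obtain ⟨m, j, hm, hb⟩ := exists_isTranscendenceBasis_of_adjoin_eq_top (B := B) ha
    ((ringKrullDim_eq_iff_trdeg_eq K A d).mp hd) ((ringKrullDim_eq_iff_trdeg_eq K B e).mp he)
  refine ⟨m, j, hm, fun {Ω Ω'} _ _ _ _ _ _ _ g hg w hw ↦ ?_⟩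
  let ψ : B →ₐ[K] Ω := Ideal.Quotient.liftₐ J (aeval w) fun f hf ↦ (hw f).mpr hf
  have hψ : Function.Injective ψ := by
    refine (injective_iff_map_eq_zero ψ).mpr fun y hy ↦ ?_
    obtain ⟨f, rfl⟩ := Ideal.Quotient.mk_surjective y
    exact Ideal.Quotient.eq_zero_iff_mem.mpr ((hw f).mp hy)
  obtain ⟨φ, hφψ, hφg⟩ := exists_ringHom_of_isTranscendenceBasis hb (ψ := ψ.toRingHom) hψ hg
  let φ' : A →ₐ[K] Ω' := { φ with
    commutes' c := by
      change φ (algebraMap K A c) = _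
      rw [IsScalarTower.algebraMap_apply K B A, hφψ, IsScalarTower.algebraMap_apply K Ω Ω']
      exact congr_arg _ (ψ.commutes c) }
  refine ⟨fun s ↦ φ' (Ideal.Quotient.mk I (X s)), fun s ↦ ?_, hφg, fun f hf ↦ ?_⟩
  · have := hφψ (Ideal.Quotient.mk J (X s))
    rw [hmap, rename_X] at this
    refine this.trans (congr_arg _ ?_)
    change aeval w (X s) = w s
    rw [aeval_X]
  · have := DFunLike.congr_fun (aeval_unique (φ'.comp (Ideal.Quotient.mkₐ K I))).symm f
    refine this.trans ?_
    change φ' (Ideal.Quotient.mk I f) = 0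
    rw [Ideal.Quotient.eq_zero_iff_mem.mpr hf, map_zero]

universe u

theorem exists_isAlgClosed_algebraicIndependent (F : Type u) [Field F] (m : ℕ) :
    ∃ (Ω : Type u) (_ : Field Ω) (_ : IsAlgClosed Ω) (_ : Algebra F Ω) (t : Fin m → Ω),
      AlgebraicIndependent F t := by
  let E := FractionRing (MvPolynomial (Fin m) F)
  have hE : AlgebraicIndependent F fun i ↦ algebraMap (MvPolynomial (Fin m) F) E (X i) :=
    (algebraicIndependent_X (Fin m) F).map' (f := IsScalarTower.toAlgHom F _ E)
      (IsFractionRing.injective (MvPolynomial (Fin m) F) E)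
  exact ⟨AlgebraicClosure E, inferInstance, inferInstance, inferInstance, _,
    hE.map' (f := IsScalarTower.toAlgHom F E (AlgebraicClosure E))
      (algebraMap E (AlgebraicClosure E)).injective⟩

theorem sum_sum_ite_eq_mul {R σ τ : Type*} [CommSemiring R] [Fintype σ] [Fintype τ]
    [DecidableEq τ] (ρ : σ → τ) (c : σ → R) (x : τ → R) :
    ∑ l, (∑ s, if ρ s = l then c s else 0) * x l = ∑ s, c s * x (ρ s) := by
  simp_rw [Finset.sum_mul]
  rw [Finset.sum_comm]
  simp

/-- Let `I` be a prime ideal in `K[x₁,…,xₙ]` of dimension `d`, and let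
`I_k = I ∩ K[x₁,…,x_k]` be its elimination ideal, of dimension `d_k`.
Then `deg(I_k) ≤ deg(I)`. -/
theorem stmt4 (K : Type*) [Field K] (n k : ℕ) (hk : 1 ≤ k) (hkn : k ≤ n)
    (I : Ideal (MvPolynomial (Fin n) K)) (hI : I.IsPrime)
    (d dk : ℕ)
    (hd : ringKrullDim (MvPolynomial (Fin n) K ⧸ I) = d)
    (hdk : ringKrullDim (MvPolynomial (Fin k) K ⧸
      I.comap (rename (Fin.castLE hkn) :
        MvPolynomial (Fin k) K →ₐ[K] MvPolynomial (Fin n) K).toRingHom) = dk) :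
    idealDeg (I.comap (rename (Fin.castLE hkn) :
        MvPolynomial (Fin k) K →ₐ[K] MvPolynomial (Fin n) K).toRingHom) dk ≤
      idealDeg I d := by
  let L := AlgebraicClosure K
  refine sSup_le ?_
  rintro _ ⟨c, c₀, hfin, rfl⟩
  obtain ⟨m, j, hm, hext⟩ := exists_extend_point_of_comap_rename (Fin.castLE hkn) I hd hdk
  let J := I.comap (rename (Fin.castLE hkn) :
    MvPolynomial (Fin k) K →ₐ[K] MvPolynomial (Fin n) K).toRingHom
  have : J.IsPrime := Ideal.comap_isPrime _ _
  let y (i : Fin dk) : MvPolynomial (Fin k) L := C (c₀ i) + ∑ s, C (c i s) * X s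
  have hy (x : Fin k → L) (i : Fin dk) : aeval x (y i) = c₀ i + ∑ s, c i s * x s := by
    simp [y]
  have hset : zeroSet J ∩ {x | ∀ i, c₀ i + ∑ s, c i s * x s = 0} =
      {x : Fin k → L | (∀ f ∈ J, aeval x f = 0) ∧ ∀ i, aeval x (y i) = 0} := by
    ext x
    refine and_congr Iff.rfl (forall_congr' fun i ↦ ?_)
    rw [hy]
  rw [hset] at hfin ⊢
  obtain ⟨Ω, _, _, _, t, ht⟩ := exists_isAlgClosed_algebraicIndependent L dk
  let _ : Algebra K Ω := ((algebraMap L Ω).comp (algebraMap K L)).toAlgebra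
  have : IsScalarTower K L Ω := .of_algebraMap_eq fun _ ↦ rfl
  obtain ⟨w, hw, hwy, hwJ⟩ := exists_lift_family J (by rwa [Nat.card_fin]) y hfin ht
  obtain ⟨Ω', _, _, _, g, hg⟩ := exists_isAlgClosed_algebraicIndependent Ω m
  let _ : Algebra L Ω' := ((algebraMap Ω Ω').comp (algebraMap L Ω)).toAlgebra
  have : IsScalarTower L Ω Ω' := .of_algebraMap_eq fun _ ↦ rfl
  let _ : Algebra K Ω' := ((algebraMap L Ω').comp (algebraMap K L)).toAlgebra
  have : IsScalarTower K L Ω' := .of_algebraMap_eq fun _ ↦ rfl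
  have : IsScalarTower K Ω Ω' := .of_algebraMap_eq fun _ ↦ rfl
  have := hfin.to_subtype
  choose v hvw hvg hvI using fun x ↦ hext hg (w x) (hwJ x)
  have hv : Function.Injective v := fun x x' h ↦ hw <| funext fun s ↦
    (algebraMap Ω Ω').injective <| by rw [← hvw, ← hvw, h]
  let z : Fin m ⊕ Fin dk → MvPolynomial (Fin n) L :=
    Sum.elim (fun i ↦ X (j i)) fun i ↦ rename (Fin.castLE hkn) (y i)
  obtain ⟨θ₀, x, hx, hxmem, hxfin⟩ := exists_injective_specialization I hd
    (by simp [← hm, add_comm]) z (ht.sumElim_comp hg) (v := v) hv hvI (by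
      rintro p (i | i)
      · simpa [z] using hvg p i
      · have : v p ∘ Fin.castLE hkn = fun s ↦ algebraMap Ω Ω' (w p s) := funext (hvw p)
        simp only [z, Sum.elim_inr, aeval_rename, this, Function.comp_apply, ← hwy p i]
        exact (comp_aeval_apply (w p) (IsScalarTower.toAlgHom L Ω Ω') (y i)).symm)
  have := hxfin.to_subtype
  let ε : Fin d ≃ Fin m ⊕ Fin dk := (finCongr (by omega)).trans finSumFinEquiv.symm
  let b : Fin m ⊕ Fin dk → Fin n → L := Sum.elim (fun i ↦ Pi.single (j i) 1)
    fun i l ↦ ∑ s, if Fin.castLE hkn s = l then c i s else 0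
  let b₀ : Fin m ⊕ Fin dk → L := Sum.elim 0 c₀
  have hz (x : Fin n → L) (i : Fin m ⊕ Fin dk) :
      aeval x (z i) = b₀ i + ∑ l, b i l * x l := by
    obtain i | i := i
    · simp [z, b, b₀, Pi.single_apply]
    · simp only [z, b, b₀, Sum.elim_inr, aeval_rename, hy]
      exact congr_arg _ (sum_sum_ite_eq_mul (Fin.castLE hkn) (c i) x).symm
  have hset' : zeroSet I ∩ {x | ∀ i, (b₀ (ε i) - θ₀ (ε i)) + ∑ l, b (ε i) l * x l = 0} =
      {x : Fin n → L | (∀ f ∈ I, aeval x f = 0) ∧ ∀ i, aeval x (z i) = θ₀ i} := by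
    ext x
    refine and_congr Iff.rfl ?_
    rw [Set.mem_ofPred_eq, ε.forall_congr_left]
    refine forall_congr' fun i ↦ ?_
    rw [hz, Equiv.apply_symm_apply, ← sub_eq_zero (b := θ₀ i)]
    exact Eq.congr_left (by ring)
  refine le_trans ?_ (le_sSup ⟨fun i ↦ b (ε i), fun i ↦ b₀ (ε i) - θ₀ (ε i), ?_, rfl⟩)
  · rw [hset']
    exact_mod_cast Nat.card_le_card_of_injective (Set.codRestrict x _ hxmem) fun p p' h ↦
      hx congr(($h).1)
  · rwa [hset']
end
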